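/- For every n ≥ 1 and every pair of nonnegative integers r, s with r + 2s = n, there exist constants c_1, c_2 > 0 depending only on n such that for all sufficiently large H, the number D of polynomials f ∈ ℤ[X] of degree n (nonzero leading coefficient) with height at most H having exactly r real roots and exactly 2s non-real roots (with multiplicity) satisfies c_1 H^{n+1} ≤ D ≤ c_2 H^{n+1}. -/

import Mathlib

open Polynomial

/-- A complex polynomial whose value at `z` is small compared with its leading coefficient has a
root near `z`. -/
theorem exists_mem_roots_norm_sub_lt {f : ℂ[X]} {z : ℂ} {ε : ℝ} (hε : 0 ≤ ε)
    (h : ‖f.eval z‖ < ‖f.leadingCoeff‖ * ε ^ f.natDegree) :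
    ∃ w ∈ f.roots, ‖w - z‖ < ε := by
  by_contra! hfar
  refine absurd h (not_lt.mpr ?_)
  have hsplit := IsAlgClosed.splits f
  rw [hsplit.eval_eq_prod_roots, norm_mul]
  refine mul_le_mul_of_nonneg_left ?_ (norm_nonneg _)
  rw [← splits_iff_card_roots.mp hsplit, ← Multiset.prod_replicate, ← Multiset.map_const',
    ← coe_nnnorm, ← nnnormHom_apply, map_multiset_prod, Multiset.map_map]
  push_cast
  rw [Multiset.map_map]
  refine Multiset.prod_map_le_prod_map₀ _ _ (fun _ _ => hε) fun w hw => ?_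
  simpa [norm_sub_rev] using hfar w hw

theorem conj_mem_roots_map_intCast {f : ℤ[X]} {w : ℂ}
    (hw : w ∈ (f.map (Int.castRingHom ℂ)).roots) :
    starRingEnd ℂ w ∈ (f.map (Int.castRingHom ℂ)).roots := by
  rw [mem_roots'] at hw ⊢
  refine ⟨hw.1, ?_⟩
  have h := congrArg (starRingEnd ℂ) hw.2.eq_zero
  rw [eval_map, hom_eval₂, map_zero] at h
  rw [IsRoot, eval_map, ← h]
  congr 1
  exact Subsingleton.elim _ _

/-- If a conjugation-invariant polynomial of degree `n` has a root near each of `n` well-separated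
points, some of which are real and the others far from the real axis, then its roots are real or
non-real as these points are. -/
theorem card_filter_im_roots_of_near {α β : Type*} [Fintype α] [Fintype β] {f : ℂ[X]}
    (hconj : ∀ w ∈ f.roots, starRingEnd ℂ w ∈ f.roots)
    (hcard : f.natDegree = Fintype.card α + Fintype.card β) (z : α ⊕ β → ℂ)
    (hsep : ∀ i j, ‖z i - z j‖ < 1 → i = j) (hre : ∀ a, (z (.inl a)).im = 0)
    (him : ∀ b, 1 ≤ |(z (.inr b)).im|)
    (hnear : ∀ i, ∃ w ∈ f.roots, ‖w - z i‖ < 1 / 4) :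
    (f.roots.filter fun w => w.im = 0).card = Fintype.card α ∧
      (f.roots.filter fun w => w.im ≠ 0).card = Fintype.card β := by
  classical
  choose φ hφ hφz using hnear
  have hinj : Function.Injective φ := fun i j hij => by
    refine hsep i j ?_
    have h1 := hφz i
    have h2 := hφz j
    rw [hij, norm_sub_rev] at h1
    calc ‖z i - z j‖ ≤ ‖z i - φ j‖ + ‖φ j - z j‖ := norm_sub_le_norm_sub_add_norm_sub _ _ _
      _ < 1 := by linarith
  have hroots : Finset.univ.val.map φ = f.roots := by
    refine Multiset.eq_of_le_of_card_le ?_ ?_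
    · rw [Multiset.le_iff_subset (Finset.univ.nodup.map hinj)]
      intro w hw
      obtain ⟨i, -, rfl⟩ := Multiset.mem_map.mp hw
      exact hφ i
    · refine (card_roots' f).trans ?_
      simp [hcard]
  have hφre : ∀ a, (φ (.inl a)).im = 0 := fun a => by
    have hmem := hconj _ (hφ (.inl a))
    rw [← hroots] at hmem
    obtain ⟨j, -, hj⟩ := Multiset.mem_map.mp hmem
    have hza : starRingEnd ℂ (z (.inl a)) = z (.inl a) := Complex.conj_eq_iff_im.mpr (hre a)
    have h1 : ‖φ j - z (.inl a)‖ < 1 / 4 := by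
      rw [hj, ← hza, ← map_sub, RCLike.norm_conj]
      exact hφz _
    have h2 := hφz j
    rw [norm_sub_rev] at h2
    have hja : j = .inl a := hsep _ _ <|
      calc ‖z j - z (.inl a)‖ ≤ ‖z j - φ j‖ + ‖φ j - z (.inl a)‖ :=
            norm_sub_le_norm_sub_add_norm_sub _ _ _
        _ < 1 := by linarith
    rw [hja] at hj
    exact Complex.conj_eq_iff_im.mp hj.symm
  have hφim : ∀ b, (φ (.inr b)).im ≠ 0 := fun b h0 => by
    have h1 := (Complex.abs_im_le_norm _).trans_lt (hφz (.inr b))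
    rw [Complex.sub_im, h0, zero_sub, abs_neg] at h1
    linarith [him b]
  have huniv : (Finset.univ : Finset (α ⊕ β)).val =
      Finset.univ.val.map Sum.inl + Finset.univ.val.map Sum.inr := rfl
  rw [← hroots, huniv, Multiset.map_add, Multiset.map_map, Multiset.map_map]
  constructor
  · rw [Multiset.filter_add, Multiset.filter_eq_self.mpr, Multiset.filter_eq_nil.mpr] <;>
      simp [hφre, hφim]
  · rw [Multiset.filter_add, Multiset.filter_eq_nil.mpr, Multiset.filter_eq_self.mpr] <;>
      simp [hφre, hφim]

/-- Polynomials whose coefficients are close to those of `N • h`, where `h` is monic, have roots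
near the roots of `h`. -/
theorem exists_forall_near_root {h : ℤ[X]} (hmonic : h.Monic) {ι : Type*} [Finite ι] (z : ι → ℂ)
    (hz : ∀ i, h.eval₂ (Int.castRingHom ℂ) (z i) = 0) {ε : ℝ} (hε : 0 < ε) :
    ∃ δ : ℝ, 0 < δ ∧ δ ≤ 1 / 2 ∧ ∀ (f : ℤ[X]) (N : ℝ), 0 < N → f.natDegree ≤ h.natDegree →
      (∀ i ≤ h.natDegree, |(f.coeff i : ℝ) - N * h.coeff i| ≤ δ * N) →
      f.natDegree = h.natDegree ∧
        ∀ i, ∃ w ∈ (f.map (Int.castRingHom ℂ)).roots, ‖w - z i‖ < ε := by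
  classical
  cases nonempty_fintype ι
  set n := h.natDegree with hn
  set C : ℝ := 1 + ∑ i, ∑ k ∈ Finset.range (n + 1), ‖z i‖ ^ k with hC
  have hC1 : 0 < C := by positivity
  refine ⟨min (1 / 2) (ε ^ n / (2 * C)), by positivity, min_le_left _ _, ?_⟩
  set δ := min (1 / 2) (ε ^ n / (2 * C)) with hδ
  have hδ2 : δ ≤ 1 / 2 := min_le_left _ _
  have hδ0 : 0 < δ := by positivity
  have hδC : δ * C ≤ ε ^ n / 2 := by
    have : δ ≤ ε ^ n / (2 * C) := min_le_right _ _
    calc δ * C ≤ ε ^ n / (2 * C) * C := by gcongr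
      _ = ε ^ n / 2 := by field_simp
  intro f N hN hdeg hclose
  have hlead : N / 2 ≤ f.coeff n := by
    have h1 := (abs_le.mp (hclose n le_rfl)).1
    rw [hn, hmonic.coeff_natDegree] at h1
    push_cast at h1
    nlinarith
  have hfn : f.natDegree = n := by
    refine le_antisymm hdeg (le_natDegree_of_ne_zero fun h0 => ?_)
    rw [h0] at hlead
    push_cast at hlead
    linarith
  refine ⟨hfn, fun i => exists_mem_roots_norm_sub_lt hε.le ?_⟩
  have hinj : Function.Injective (Int.castRingHom ℂ) := Int.cast_injective
  rw [natDegree_map_eq_of_injective hinj, leadingCoeff_map_of_injective hinj, leadingCoeff, hfn,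
    eval_map]
  have hval : f.eval₂ (Int.castRingHom ℂ) (z i) =
      ∑ k ∈ Finset.range (n + 1), ((f.coeff k : ℂ) - N * h.coeff k) * z i ^ k := by
    have hz' := hz i
    rw [eval₂_eq_sum_range' _ (Nat.lt_succ_self _)] at hz'
    rw [eval₂_eq_sum_range' _ (by omega : f.natDegree < n + 1)]
    simp only [sub_mul, Finset.sum_sub_distrib, mul_assoc, ← Finset.mul_sum]
    simp only [eq_intCast] at hz' ⊢
    rw [hz', mul_zero, sub_zero]
  have hsum : ∑ k ∈ Finset.range (n + 1), ‖z i‖ ^ k < C := by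
    have := Finset.single_le_sum
      (f := fun i => ∑ k ∈ Finset.range (n + 1), ‖z i‖ ^ k) (fun _ _ => by positivity)
      (Finset.mem_univ i)
    linarith
  calc ‖f.eval₂ (Int.castRingHom ℂ) (z i)‖
      ≤ ∑ k ∈ Finset.range (n + 1), δ * N * ‖z i‖ ^ k := by
        rw [hval]
        refine norm_sum_le_of_le _ fun k hk => ?_
        rw [norm_mul, norm_pow]
        gcongr
        have := hclose k (by simpa [Nat.lt_succ_iff] using hk)
        rw [← Real.norm_eq_abs, ← Complex.norm_real] at this
        simpa using this
    _ = δ * N * ∑ k ∈ Finset.range (n + 1), ‖z i‖ ^ k := by rw [Finset.mul_sum]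
    _ < δ * N * C := by gcongr
    _ = N * (δ * C) := by ring
    _ ≤ N * (ε ^ n / 2) := by gcongr
    _ = N / 2 * ε ^ n := by ring
    _ ≤ ‖Int.castRingHom ℂ (f.coeff n)‖ * ε ^ n := by
        gcongr
        rw [eq_intCast, Complex.norm_intCast]
        exact hlead.trans (le_abs_self _)

/-- There is a monic integer polynomial with `r` real roots and `2 * s` non-real roots, all of them
simple and well separated. -/
theorem exists_monic_separated_roots (r s : ℕ) :
    ∃ (h : ℤ[X]) (z : Fin r ⊕ (Fin s ⊕ Fin s) → ℂ), h.Monic ∧ h.natDegree = r + 2 * s ∧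
      (∀ i, h.eval₂ (Int.castRingHom ℂ) (z i) = 0) ∧ (∀ i j, ‖z i - z j‖ < 1 → i = j) ∧
      (∀ a, (z (.inl a)).im = 0) ∧ ∀ b, 1 ≤ |(z (.inr b)).im| := by
  let z : Fin r ⊕ (Fin s ⊕ Fin s) → ℂ := Sum.elim (fun j => ⟨(j : ℕ), 0⟩)
    (Sum.elim (fun k => ⟨0, (k : ℕ) + 1⟩) fun k => ⟨0, -((k : ℕ) + 1)⟩)
  have hm1 : ∀ j ∈ (Finset.univ : Finset (Fin r)), (X - C ((j : ℕ) : ℤ)).Monic :=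
    fun j _ => monic_X_sub_C _
  have hm2 : ∀ k ∈ (Finset.univ : Finset (Fin s)),
      (X ^ 2 + C ((((k : ℕ) : ℤ) + 1) ^ 2)).Monic :=
    fun k _ => monic_X_pow_add_C _ two_ne_zero
  refine ⟨(∏ j : Fin r, (X - C ((j : ℕ) : ℤ))) *
    ∏ k : Fin s, (X ^ 2 + C ((((k : ℕ) : ℤ) + 1) ^ 2)), z,
    (monic_prod_of_monic _ _ hm1).mul (monic_prod_of_monic _ _ hm2), ?_, ?_, ?_, ?_, ?_⟩
  · rw [(monic_prod_of_monic _ _ hm1).natDegree_mul (monic_prod_of_monic _ _ hm2),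
      natDegree_prod_of_monic _ _ hm1, natDegree_prod_of_monic _ _ hm2]
    simp only [natDegree_X_sub_C, natDegree_X_pow_add_C, Finset.sum_const, Finset.card_univ,
      Fintype.card_fin, smul_eq_mul]
    ring
  · intro i
    rw [eval₂_mul, eval₂_finsetProd, eval₂_finsetProd, mul_eq_zero, Finset.prod_eq_zero_iff,
      Finset.prod_eq_zero_iff]
    rcases i with j | k | k
    · exact .inl ⟨j, Finset.mem_univ _, by simp [z, Complex.ext_iff]⟩
    · exact .inr ⟨k, Finset.mem_univ _, by simp [z, Complex.ext_iff, pow_two]⟩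
    · refine .inr ⟨k, Finset.mem_univ _, ?_⟩
      simp [z, Complex.ext_iff, pow_two]
      ring
  · intro i j hij
    have hre := (Complex.abs_re_le_norm _).trans_lt hij
    have him := (Complex.abs_im_le_norm _).trans_lt hij
    have key : ∀ a b : ℕ, -1 < (a : ℝ) - b → (a : ℝ) - b < 1 → a = b := fun a b h1 h2 => by
      have h3 : (b : ℝ) < a + 1 := by linarith
      have h4 : (a : ℝ) < b + 1 := by linarith
      norm_cast at h3 h4
      omega
    rcases i with i | i | i <;> rcases j with j | j | j <;>
      simp only [z, Sum.elim_inl, Sum.elim_inr, Complex.sub_re, Complex.sub_im, abs_lt] at hre him <;>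
      have hi := Nat.cast_nonneg (α := ℝ) (i : ℕ) <;>
      have hj := Nat.cast_nonneg (α := ℝ) (j : ℕ) <;>
      first
      | exfalso; linarith
      | rw [Fin.ext (key i j (by linarith) (by linarith))]
  · exact fun a => rfl
  · rintro (k | k)
    · exact le_abs.mpr (.inl (by simp [z]))
    · exact le_abs.mpr (.inr (by simp [z]))

/-- The integer polynomials of degree at most `n` and height at most `H` number at most
`(2 * H + 1) ^ (n + 1)`. -/
theorem finite_and_ncard_le_of_height_le (n H : ℕ) {S : Set ℤ[X]}
    (hS : ∀ f ∈ S, f.natDegree ≤ n ∧ ∀ i, |f.coeff i| ≤ (H : ℤ)) :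
    S.Finite ∧ S.ncard ≤ (2 * H + 1) ^ (n + 1) := by
  classical
  set T : Finset (Fin (n + 1) → ℤ) := Fintype.piFinset fun _ => Finset.Icc (-(H : ℤ)) H with hT
  have hmaps : ∀ f ∈ S, toFn (n + 1) f ∈ (T : Set (Fin (n + 1) → ℤ)) := fun f hf => by
    rw [Finset.mem_coe, hT, Fintype.mem_piFinset]
    exact fun i => Finset.mem_Icc.mpr (abs_le.mp ((hS f hf).2 i))
  have hinj : Set.InjOn (toFn (n + 1)) S := fun f hf g hg hfg => by
    rw [← ofFn_comp_toFn_eq_id_of_natDegree_lt (Nat.lt_succ_of_le (hS f hf).1), hfg,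
      ofFn_comp_toFn_eq_id_of_natDegree_lt (Nat.lt_succ_of_le (hS g hg).1)]
  refine ⟨.of_injOn hmaps hinj T.finite_toSet, ?_⟩
  refine (Set.ncard_le_ncard_of_injOn _ hmaps hinj T.finite_toSet).trans_eq ?_
  rw [Set.ncard_coe_finset, hT, Fintype.card_piFinset]
  simp only [Int.card_Icc, Finset.prod_const, Finset.card_univ, Fintype.card_fin]
  congr 1
  omega

/-- A set of integer polynomials containing all small perturbations of a given polynomial has at
least as many elements as there are such perturbations. -/
theorem pow_le_ncard_of_forall_mem (n m : ℕ) (g : ℤ[X]) {S : Set ℤ[X]} (hfin : S.Finite)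
    (hS : ∀ f : ℤ[X], f.natDegree ≤ n → (∀ i ≤ n, |f.coeff i - g.coeff i| ≤ (m : ℤ)) → f ∈ S) :
    (m + 1) ^ (n + 1) ≤ S.ncard := by
  classical
  set T : Finset (Fin (n + 1) → ℤ) :=
    Fintype.piFinset fun i => Finset.Icc (g.coeff i) (g.coeff i + m) with hT
  have hcard : T.card = (m + 1) ^ (n + 1) := by
    rw [hT, Fintype.card_piFinset]
    simp only [Int.card_Icc]
    rw [Finset.prod_congr rfl fun i _ => show _ = m + 1 by omega]
    simp
  rw [← hcard, ← Set.ncard_coe_finset]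
  refine Set.ncard_le_ncard_of_injOn (ofFn (n + 1)) (fun v hv => hS _ ?_ fun i hi => ?_)
    (injective_ofFn _).injOn hfin
  · exact Nat.lt_succ_iff.mp (ofFn_natDegree_lt (Nat.succ_pos n) v)
  · have := Fintype.mem_piFinset.mp (Finset.mem_coe.mp hv) ⟨i, Nat.lt_succ_of_le hi⟩
    rw [Finset.mem_Icc] at this
    rw [ofFn_coeff_eq_val_of_lt _ (Nat.lt_succ_of_le hi), abs_le]
    simp only at this
    omega

/-- For every n ≥ 1 and r + 2s = n, there are constants c₁, c₂ > 0 depending only on n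
such that for all sufficiently large H, the number D of integer polynomials of degree n and
height at most H with exactly r real roots and 2s non-real roots (with multiplicity)
satisfies c₁·H^(n+1) ≤ D ≤ c₂·H^(n+1). -/
theorem count_r_real_2s_nonreal (n r s : ℕ) (hn : 1 ≤ n) (hrs : r + 2 * s = n) :
    ∃ c₁ c₂ : ℝ, 0 < c₁ ∧ 0 < c₂ ∧ ∃ H₀ : ℕ, ∀ H : ℕ, H₀ ≤ H →
      c₁ * (H : ℝ) ^ (n + 1) ≤
        (({ f : Polynomial ℤ | f.natDegree = n ∧ (∀ i, |f.coeff i| ≤ (H : ℤ)) ∧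
          ((f.map (Int.castRingHom ℂ)).roots.filter fun z => z.im = 0).card = r ∧
          ((f.map (Int.castRingHom ℂ)).roots.filter fun z => z.im ≠ 0).card = 2 * s }
            : Set (Polynomial ℤ)).ncard : ℝ) ∧
      (({ f : Polynomial ℤ | f.natDegree = n ∧ (∀ i, |f.coeff i| ≤ (H : ℤ)) ∧
          ((f.map (Int.castRingHom ℂ)).roots.filter fun z => z.im = 0).card = r ∧
          ((f.map (Int.castRingHom ℂ)).roots.filter fun z => z.im ≠ 0).card = 2 * s }
            : Set (Polynomial ℤ)).ncard : ℝ) ≤ c₂ * (H : ℝ) ^ (n + 1) := by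
  obtain ⟨h, z, hmonic, hdeg, hz, hsep, hre, him⟩ := exists_monic_separated_roots r s
  obtain ⟨δ, hδ0, hδ1, hδ⟩ :=
    exists_forall_near_root hmonic z hz (by norm_num : (0 : ℝ) < 1 / 4)
  rw [hdeg, hrs] at hδ
  obtain ⟨M, hM⟩ : ∃ M : ℕ, ∀ i, |h.coeff i| ≤ (M : ℤ) := by
    refine ⟨∑ i ∈ h.support, (h.coeff i).natAbs, fun i => ?_⟩
    by_cases hi : i ∈ h.support
    · rw [Int.abs_eq_natAbs]
      exact_mod_cast Finset.single_le_sum (f := fun i => (h.coeff i).natAbs)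
        (fun _ _ => Nat.zero_le _) hi
    · rw [notMem_support_iff.mp hi, abs_zero]
      positivity
  refine ⟨(δ / (2 * (M + 1))) ^ (n + 1), 3 ^ (n + 1), by positivity, by positivity, M + 1,
    fun H hH => ?_⟩
  set S : Set ℤ[X] := { f | f.natDegree = n ∧ (∀ i, |f.coeff i| ≤ (H : ℤ)) ∧
    ((f.map (Int.castRingHom ℂ)).roots.filter fun z => z.im = 0).card = r ∧
    ((f.map (Int.castRingHom ℂ)).roots.filter fun z => z.im ≠ 0).card = 2 * s } with hS
  obtain ⟨hfin, hupper⟩ := finite_and_ncard_le_of_height_le n H (S := S)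
    fun f hf => ⟨hf.1.le, hf.2.1⟩
  set N := H / (M + 1) with hN
  have hN1 : 1 ≤ N := (Nat.one_le_div_iff (Nat.succ_pos M)).mpr hH
  have hNH : N * (M + 1) ≤ H := Nat.div_mul_le_self _ _
  have hHN : (H : ℝ) ≤ 2 * (M + 1) * N := by
    have h1 : H < (M + 1) * (N + 1) := Nat.lt_mul_div_succ H (Nat.succ_pos M)
    have h2 : (M + 1) * (N + 1) ≤ 2 * (M + 1) * N := by nlinarith
    exact_mod_cast h1.le.trans h2
  set m := ⌊δ * N⌋₊ with hm
  have hmδ : (m : ℝ) ≤ δ * N := Nat.floor_le (by positivity)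
  have hmN : m ≤ N := by
    have : (m : ℝ) ≤ N := hmδ.trans (mul_le_of_le_one_left (by positivity) (by linarith))
    exact_mod_cast this
  have hlower : (m + 1) ^ (n + 1) ≤ S.ncard := by
    refine pow_le_ncard_of_forall_mem n m (C (N : ℤ) * h) hfin fun f hfn hf => ?_
    simp only [coeff_C_mul] at hf
    obtain ⟨hfdeg, hnear⟩ := hδ f N (by exact_mod_cast hN1) hfn fun i hi => by
      refine le_trans ?_ hmδ
      exact_mod_cast hf i hi
    have hcount := card_filter_im_roots_of_near (fun w hw => conj_mem_roots_map_intCast hw)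
      (by rw [natDegree_map_eq_of_injective Int.cast_injective, hfdeg]; simp; omega)
      z hsep hre him hnear
    simp only [Fintype.card_sum, Fintype.card_fin, ← two_mul] at hcount
    refine ⟨hfdeg, fun i => ?_, hcount⟩
    rcases le_or_gt i n with hi | hi
    · calc |f.coeff i| = |(f.coeff i - N * h.coeff i) + N * h.coeff i| := by ring_nf
        _ ≤ |f.coeff i - N * h.coeff i| + |N * h.coeff i| := abs_add_le _ _
        _ ≤ m + N * M := by
          rw [abs_mul, Nat.abs_cast]
          gcongr
          exacts [hf i hi, hM i]
        _ ≤ H := by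
          have : m + N * M ≤ H := by nlinarith
          exact_mod_cast this
    · rw [coeff_eq_zero_of_natDegree_lt (by omega), abs_zero]
      positivity
  constructor
  · calc (δ / (2 * (M + 1))) ^ (n + 1) * (H : ℝ) ^ (n + 1)
        = (δ / (2 * (M + 1)) * H) ^ (n + 1) := (mul_pow _ _ _).symm
      _ ≤ ((m : ℝ) + 1) ^ (n + 1) := by
        refine pow_le_pow_left₀ (by positivity) ?_ _
        calc δ / (2 * (M + 1)) * H ≤ δ / (2 * (M + 1)) * (2 * (M + 1) * N) := by gcongr
          _ = δ * N := by field_simp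
          _ ≤ m + 1 := (Nat.lt_floor_add_one _).le
      _ ≤ S.ncard := by exact_mod_cast hlower
  · calc (S.ncard : ℝ) ≤ (2 * H + 1) ^ (n + 1) := by exact_mod_cast hupper
      _ ≤ (3 * H) ^ (n + 1) := by
        have : (1 : ℝ) ≤ H := by exact_mod_cast (Nat.succ_pos M).trans_le hH
        gcongr
        linarith
      _ = 3 ^ (n + 1) * (H : ℝ) ^ (n + 1) := mul_pow _ _ _
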